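/- For all integers m, n ≥ 3, the number of knot (m,n)-mosaics satisfies the upper bound 275 · D_{m,n} ≤ (4.4)^{(m-3)(n-3)} · 2(9·6^{m-2} + 1)(9·6^{n-2} + 1); equivalently, 275 · 5^{(m-3)(n-3)} · D_{m,n} ≤ 22^{(m-3)(n-3)} · 2(9·6^{m-2} + 1)(9·6^{n-2} + 1). -/

import Mathlib

/-- The eleven mosaic tiles `T₀, …, T₁₀`. -/
inductive Tile : Type
  | T0 | T1 | T2 | T3 | T4 | T5 | T6 | T7 | T8 | T9 | T10
  deriving DecidableEq

namespace Tile

/-- Whether the top edge of a tile carries a connection point.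
`T0` has no connection points; `T1,…,T6` realize the six unordered pairs of edges
(`T1`: bottom–left, `T2`: bottom–right, `T3`: top–right, `T4`: top–left,
`T5`: left–right, `T6`: top–bottom); `T7,…,T10` have all four. -/
def top : Tile → Bool
  | .T3 | .T4 | .T6 | .T7 | .T8 | .T9 | .T10 => true
  | _ => false

/-- Whether the bottom edge of a tile carries a connection point. -/
def bottom : Tile → Bool
  | .T1 | .T2 | .T6 | .T7 | .T8 | .T9 | .T10 => true
  | _ => false

/-- Whether the left edge of a tile carries a connection point. -/
def left : Tile → Bool
  | .T1 | .T4 | .T5 | .T7 | .T8 | .T9 | .T10 => true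
  | _ => false

/-- Whether the right edge of a tile carries a connection point. -/
def right : Tile → Bool
  | .T2 | .T3 | .T5 | .T7 | .T8 | .T9 | .T10 => true
  | _ => false

end Tile

/-- An `(m,n)`-mosaic `M : Fin m → Fin n → Tile` (rows indexed top-to-bottom,
columns left-to-right) is suitably connected if any pair of contiguous tiles
have or do not have connection points simultaneously on their common edge. -/
def SuitablyConnected {m n : ℕ} (M : Fin m → Fin n → Tile) : Prop :=
  (∀ (i : Fin m) (j : Fin n) (h : (j : ℕ) + 1 < n),
    (M i j).right = (M i ⟨(j : ℕ) + 1, h⟩).left) ∧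
  (∀ (i : Fin m) (j : Fin n) (h : (i : ℕ) + 1 < m),
    (M i j).bottom = (M ⟨(i : ℕ) + 1, h⟩ j).top)

/-- None of the boundary edges of the mosaic carries a connection point. -/
def BoundaryFree {m n : ℕ} (M : Fin m → Fin n → Tile) : Prop :=
  ∀ (i : Fin m) (j : Fin n),
    ((i : ℕ) = 0 → (M i j).top = false) ∧
    ((i : ℕ) = m - 1 → (M i j).bottom = false) ∧
    ((j : ℕ) = 0 → (M i j).left = false) ∧
    ((j : ℕ) = n - 1 → (M i j).right = false)

/-- A knot `(m,n)`-mosaic is a suitably connected mosaic none of whose boundary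
edges has a connection point. -/
def IsKnotMosaic {m n : ℕ} (M : Fin m → Fin n → Tile) : Prop :=
  SuitablyConnected M ∧ BoundaryFree M

/-- `D m n`, the number of knot `(m,n)`-mosaics. -/
noncomputable def knotMosaicCount (m n : ℕ) : ℕ :=
  Nat.card {M : Fin m → Fin n → Tile // IsKnotMosaic M}

/-- `|Q^{(p,q)}|`, the number of `(p,q)`-quasimosaics (suitably connected
`(p,q)`-mosaics, with connection points allowed on boundary edges). -/
noncomputable def quasimosaicCount (p q : ℕ) : ℕ :=
  Nat.card {M : Fin p → Fin q → Tile // SuitablyConnected M}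

section Linked

variable {S X : Type*}

/-- The sequence `x` runs from the state `s` to the state `t`, where `a y` and `b y` are the
states at the two ends of a piece `y`. -/
def Linked (a b : X → S) (s t : S) : {k : ℕ} → (Fin k → X) → Prop
  | 0, _ => s = t
  | _ + 1, x => a (x 0) = s ∧ Linked a b (b (x 0)) t (Fin.tail x)

theorem linked_iff (a b : X → S) (s t : S) {k : ℕ} (x : Fin (k + 1) → X) :
    Linked a b s t x ↔
      (∀ i : Fin k, b (x i.castSucc) = a (x i.succ)) ∧ a (x 0) = s ∧ b (x (Fin.last k)) = t := by
  induction k generalizing s with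
  | zero => simp [Linked]
  | succ k ih =>
    rw [Linked, ih, Fin.forall_fin_succ]
    simp only [Fin.tail, Fin.succ_last, Fin.succ_castSucc, Fin.castSucc_zero, Fin.succ_zero_eq_one]
    constructor
    · rintro ⟨h₁, h₂, h₃, h₄⟩
      exact ⟨⟨h₃.symm, h₂⟩, h₁, h₄⟩
    · rintro ⟨⟨h₁, h₂⟩, h₃, h₄⟩
      exact ⟨h₃, h₂, h₁.symm, h₄⟩

theorem linked_iff_of_pos (a b : X → S) (s t : S) {k : ℕ} (hk : 0 < k) (x : Fin k → X) :
    Linked a b s t x ↔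
      (∀ (i : Fin k) (h : (i : ℕ) + 1 < k), b (x i) = a (x ⟨(i : ℕ) + 1, h⟩)) ∧
        (∀ i : Fin k, (i : ℕ) = 0 → a (x i) = s) ∧
        ∀ i : Fin k, (i : ℕ) = k - 1 → b (x i) = t := by
  obtain ⟨k, rfl⟩ := Nat.exists_eq_succ_of_ne_zero hk.ne'
  rw [linked_iff]
  refine and_congr ?_ (and_congr ?_ ?_)
  · constructor
    · intro h i hi
      exact h ⟨i, by omega⟩
    · intro h i
      exact h i.castSucc (by simp)
  · constructor
    · intro h i hi
      rwa [show i = 0 from Fin.ext hi]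
    · intro h
      exact h 0 rfl
  · constructor
    · intro h i hi
      rwa [show i = Fin.last k from Fin.ext (by simpa using hi)]
    · intro h
      exact h (Fin.last k) (by simp)

/-- Splitting a linked sequence into its first piece and the rest. -/
def linkedSuccEquiv (a b : X → S) (s t : S) {k : ℕ} (P : Fin (k + 1) → X → Prop) :
    {x : Fin (k + 1) → X // Linked a b s t x ∧ ∀ i, P i (x i)} ≃
      Σ s' : S, {y : X // P 0 y ∧ a y = s ∧ b y = s'} ×
        {x : Fin k → X // Linked a b s' t x ∧ ∀ i, P i.succ (x i)} where
  toFun x := ⟨b (x.1 0), ⟨x.1 0, x.2.2 0, x.2.1.1, rfl⟩,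
    ⟨Fin.tail x.1, x.2.1.2, fun i => x.2.2 i.succ⟩⟩
  invFun z := ⟨Fin.cons z.2.1.1 z.2.2.1, by
    obtain ⟨s', ⟨y, hP, ha, rfl⟩, ⟨x, hx, hPx⟩⟩ := z
    exact ⟨⟨ha, hx⟩, Fin.cases hP hPx⟩⟩
  left_inv x := Subtype.ext (Fin.cons_self_tail x.1)
  right_inv z := by
    obtain ⟨s', ⟨y, hP, ha, rfl⟩, ⟨x, hx, hPx⟩⟩ := z
    rfl

theorem card_linked_succ [Finite X] [Fintype S] (a b : X → S) (s t : S) {k : ℕ}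
    (P : Fin (k + 1) → X → Prop) :
    Nat.card {x : Fin (k + 1) → X // Linked a b s t x ∧ ∀ i, P i (x i)} =
      ∑ s' : S, Nat.card {y : X // P 0 y ∧ a y = s ∧ b y = s'} *
        Nat.card {x : Fin k → X // Linked a b s' t x ∧ ∀ i, P i.succ (x i)} := by
  rw [Nat.card_congr (linkedSuccEquiv a b s t P), Nat.card_sigma]
  simp only [Nat.card_prod]

theorem card_linked_zero [DecidableEq S] (a b : X → S) (s t : S) (P : Fin 0 → X → Prop) :
    Nat.card {x : Fin 0 → X // Linked a b s t x ∧ ∀ i, P i (x i)} = if s = t then 1 else 0 := by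
  split_ifs with h <;> simp [Linked, h]

end Linked

instance : Fintype Tile where
  elems := {.T0, .T1, .T2, .T3, .T4, .T5, .T6, .T7, .T8, .T9, .T10}
  complete x := by cases x <;> decide

/-- The number of tiles with prescribed connection points on the left, right, top and bottom. -/
def tileCount : Bool → Bool → Bool → Bool → ℕ
  | true, true, true, true => 4
  | l, r, t, b => if xor (xor l r) (xor t b) then 0 else 1

theorem card_tile (l r t b : Bool) :
    Nat.card {y : Tile // (y.top = t ∧ y.bottom = b) ∧ y.left = l ∧ y.right = r} =
      tileCount l r t b := by
  rw [Nat.card_eq_fintype_card]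
  revert l r t b
  decide

/-- The number of tile rows with top pattern `s` and bottom pattern `t`, whose left boundary edge
is given by `h` and whose right boundary edge carries no connection point. -/
def rowCount : (n : ℕ) → Bool → (Fin n → Bool) → (Fin n → Bool) → ℕ
  | 0, h, _, _ => if h = false then 1 else 0
  | n + 1, h, s, t =>
      ∑ h', tileCount h h' (s 0) (t 0) * rowCount n h' (Fin.tail s) (Fin.tail t)

theorem card_row (n : ℕ) (h : Bool) (s t : Fin n → Bool) :
    Nat.card {r : Fin n → Tile // Linked Tile.left Tile.right h false r ∧
      ∀ j, (r j).top = s j ∧ (r j).bottom = t j} = rowCount n h s t := by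
  induction n generalizing h with
  | zero =>
    exact card_linked_zero _ _ _ _ (fun j (y : Tile) => y.top = s j ∧ y.bottom = t j)
  | succ n ih =>
    rw [card_linked_succ _ _ _ _ (fun j (y : Tile) => y.top = s j ∧ y.bottom = t j), rowCount]
    exact Finset.sum_congr rfl fun h' _ => by rw [card_tile, ← ih]; rfl

/-- The number of ways to stack `k` tile rows without connection points on the left, right and
bottom boundary, such that the top boundary is given by `s`. -/
def stackCount (n : ℕ) : ℕ → (Fin n → Bool) → ℕ
  | 0, s => if s = fun _ => false then 1 else 0
  | k + 1, s => ∑ t, rowCount n false s t * stackCount n k t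

theorem card_stack (n k : ℕ) (s : Fin n → Bool) :
    Nat.card {M : Fin k → Fin n → Tile //
      Linked (fun r j => (r j).top) (fun r j => (r j).bottom) s (fun _ => false) M ∧
        ∀ i, Linked Tile.left Tile.right false false (M i)} = stackCount n k s := by
  induction k generalizing s with
  | zero =>
    exact card_linked_zero _ _ _ _ (fun _ r => Linked Tile.left Tile.right false false r)
  | succ k ih =>
    rw [card_linked_succ _ _ _ _ (fun _ r => Linked Tile.left Tile.right false false r), stackCount]
    refine Finset.sum_congr rfl fun t _ => ?_
    rw [ih, ← card_row]
    simp only [funext_iff, forall_and]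

theorem knotMosaicCount_eq_stackCount {m n : ℕ} (hm : 0 < m) (hn : 0 < n) :
    knotMosaicCount m n = stackCount n m fun _ => false := by
  rw [← card_stack, knotMosaicCount]
  refine Nat.card_congr (Equiv.subtypeEquivRight fun M => ?_)
  simp only [linked_iff_of_pos _ _ _ _ hm, linked_iff_of_pos _ _ _ _ hn, funext_iff,
    IsKnotMosaic, SuitablyConnected, BoundaryFree]
  grind

/-- Reflection of a tile in the main diagonal. -/
def Tile.transpose : Tile → Tile
  | .T1 => .T3
  | .T3 => .T1
  | .T5 => .T6
  | .T6 => .T5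
  | x => x

theorem knotMosaicCount_comm (m n : ℕ) : knotMosaicCount m n = knotMosaicCount n m := by
  have h₁ : ∀ x : Tile, x.transpose.transpose = x := by decide
  have h₂ : ∀ x : Tile, x.transpose.top = x.left := by decide
  have h₃ : ∀ x : Tile, x.transpose.left = x.top := by decide
  have h₄ : ∀ x : Tile, x.transpose.bottom = x.right := by decide
  have h₅ : ∀ x : Tile, x.transpose.right = x.bottom := by decide
  have key : ∀ {m n : ℕ} (M : Fin m → Fin n → Tile), IsKnotMosaic M →
      IsKnotMosaic fun j i => (M i j).transpose := by
    intro m n M hM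
    simp only [IsKnotMosaic, SuitablyConnected, BoundaryFree, h₂, h₃, h₄, h₅] at hM ⊢
    obtain ⟨⟨hr, hc⟩, hb⟩ := hM
    exact ⟨⟨fun j i => hc i j, fun j i => hr i j⟩, fun j i =>
      ⟨(hb i j).2.2.1, (hb i j).2.2.2, (hb i j).1, (hb i j).2.1⟩⟩
  exact Nat.card_congr
    { toFun := fun M => ⟨_, key M.1 M.2⟩
      invFun := fun M => ⟨_, key M.1 M.2⟩
      left_inv := fun M => Subtype.ext (by simp [h₁])
      right_inv := fun M => Subtype.ext (by simp [h₁]) }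

/-- Whether an odd number of entries is `true`. -/
def parity : (n : ℕ) → (Fin n → Bool) → Bool
  | 0, _ => false
  | n + 1, s => xor (s 0) (parity n (Fin.tail s))

theorem parity_false (n : ℕ) : parity n (fun _ => false) = false := by
  induction n with
  | zero => rfl
  | succ n ih => simpa [parity, Fin.tail_def] using ih

theorem rowCount_eq_zero {n : ℕ} {h : Bool} {s t : Fin n → Bool}
    (hst : xor (parity n s) (parity n t) ≠ h) : rowCount n h s t = 0 := by
  induction n generalizing h with
  | zero => simp_all [parity, rowCount]
  | succ n ih =>
    simp only [rowCount, parity, Fintype.sum_bool] at hst ⊢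
    have h₁ := @ih true (Fin.tail s) (Fin.tail t)
    have h₂ := @ih false (Fin.tail s) (Fin.tail t)
    clear ih
    generalize rowCount n true (Fin.tail s) (Fin.tail t) = x at *
    generalize rowCount n false (Fin.tail s) (Fin.tail t) = y at *
    generalize parity n (Fin.tail s) = p at *
    generalize parity n (Fin.tail t) = q at *
    generalize s 0 = a at *
    generalize t 0 = b at *
    cases h <;> cases a <;> cases b <;> cases p <;> cases q <;> simp_all [tileCount]

theorem rowCount_false_top (n : ℕ) (h : Bool) (t : Fin n → Bool) :
    rowCount n h (fun _ => false) t = if parity n t = h then 1 else 0 := by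
  induction n generalizing h with
  | zero => cases h <;> simp [parity, rowCount]
  | succ n ih =>
    have hs : Fin.tail (fun _ : Fin (n + 1) => false) = fun _ => false := rfl
    simp only [rowCount, parity, Fintype.sum_bool, hs, ih]
    rcases Bool.eq_false_or_eq_true (t 0) with hb | hb <;>
      rcases Bool.eq_false_or_eq_true (parity n (Fin.tail t)) with hq | hq <;>
      cases h <;> simp [tileCount, hb, hq]

theorem stackCount_eq_zero {n k : ℕ} {s : Fin n → Bool} (hs : parity n s = true) :
    stackCount n k s = 0 := by
  induction k generalizing s with
  | zero =>
    rw [stackCount, if_neg]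
    rintro rfl
    simp [parity_false] at hs
  | succ k ih =>
    refine Finset.sum_eq_zero fun t _ => ?_
    cases ht : parity n t
    · rw [rowCount_eq_zero (by simp [hs, ht]), zero_mul]
    · rw [ih ht, mul_zero]

theorem stackCount_succ_false (n k : ℕ) :
    stackCount n (k + 1) (fun _ => false) = ∑ t, stackCount n k t := by
  refine Finset.sum_congr rfl fun t _ => ?_
  rw [rowCount_false_top]
  cases ht : parity n t
  · simp
  · simp [stackCount_eq_zero ht]

theorem sum_fin_succ_bool {n : ℕ} (f : (Fin (n + 1) → Bool) → ℕ) :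
    ∑ s, f s = ∑ s, f (Fin.cons true s) + ∑ s, f (Fin.cons false s) := by
  rw [← (Fin.consEquiv fun _ : Fin (n + 1) => Bool).sum_comp, Fintype.sum_prod_type,
    Fintype.sum_bool]
  rfl

/-- The entry of the `n`-th power of the matrix with rows `(1, 1)` and `(1, 4)` in the row
given by `h` and the column given by `false`. -/
def fullRowCount : ℕ → Bool → ℕ
  | 0, h => if h = false then 1 else 0
  | n + 1, false => fullRowCount n false + fullRowCount n true
  | n + 1, true => fullRowCount n false + 4 * fullRowCount n true

theorem sum_rowCount_le (n : ℕ) (h : Bool) (t : Fin n → Bool) :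
    ∑ s, rowCount n h s t ≤ fullRowCount n h := by
  induction n generalizing h with
  | zero => simp [rowCount, fullRowCount]
  | succ n ih =>
    have h₁ := ih true (Fin.tail t)
    have h₂ := ih false (Fin.tail t)
    rw [sum_fin_succ_bool]
    simp only [rowCount, Fin.cons_zero, Fin.tail_cons, Fintype.sum_bool, Finset.sum_add_distrib,
      ← Finset.mul_sum]
    cases h <;> cases t 0 <;> simp only [tileCount, fullRowCount] <;> simp <;> omega

theorem sum_stackCount_succ_le (n k : ℕ) :
    ∑ s, stackCount n (k + 1) s ≤ fullRowCount n false * ∑ t, stackCount n k t := by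
  simp only [stackCount]
  rw [Finset.sum_comm, Finset.mul_sum]
  refine Finset.sum_le_sum fun t _ => ?_
  rw [← Finset.sum_mul]
  exact Nat.mul_le_mul_right _ (sum_rowCount_le n false t)

theorem knotMosaicCount_succ_le {m n : ℕ} (hm : 2 ≤ m) (hn : 0 < n) :
    knotMosaicCount (m + 1) n ≤ fullRowCount n false * knotMosaicCount m n := by
  obtain ⟨k, rfl⟩ := Nat.exists_eq_add_of_le' hm
  rw [knotMosaicCount_eq_stackCount (by omega) hn, knotMosaicCount_eq_stackCount (by omega) hn,
    stackCount_succ_false, stackCount_succ_false]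
  exact sum_stackCount_succ_le n (k + 1)

theorem knotMosaicCount_add_le {m n : ℕ} (k : ℕ) (hm : 2 ≤ m) (hn : 0 < n) :
    knotMosaicCount (m + k) n ≤ fullRowCount n false ^ k * knotMosaicCount m n := by
  induction k with
  | zero => simp
  | succ k ih =>
    calc knotMosaicCount (m + k + 1) n
        ≤ fullRowCount n false * knotMosaicCount (m + k) n :=
          knotMosaicCount_succ_le (by omega) hn
      _ ≤ fullRowCount n false * (fullRowCount n false ^ k * knotMosaicCount m n) :=
          Nat.mul_le_mul_left _ ih
      _ = fullRowCount n false ^ (k + 1) * knotMosaicCount m n := by ring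

theorem stackCount_succ_eq_sum_even (n k : ℕ) (s : Fin n → Bool) :
    stackCount n (k + 1) s =
      ∑ t with parity n t = false, rowCount n false s t * stackCount n k t := by
  refine (Finset.sum_filter_of_ne fun t _ ht => ?_).symm
  by_contra h
  exact ht (by rw [stackCount_eq_zero (by simpa using h), mul_zero])

theorem filter_parity_three : (Finset.univ.filter fun t => parity 3 t = false) =
    {![false, false, false], ![true, false, true], ![true, true, false], ![false, true, true]} := by
  decide

theorem stackCount_three (k : ℕ) :
    5 * stackCount 3 (k + 2) ![false, false, false] = 2 * (9 * 6 ^ k + 1) ∧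
    5 * stackCount 3 (k + 2) ![true, false, true] = 2 * (9 * 6 ^ k + 1) ∧
    5 * stackCount 3 (k + 2) ![true, true, false] + 1 = 36 * 6 ^ k ∧
    5 * stackCount 3 (k + 2) ![false, true, true] + 1 = 36 * 6 ^ k := by
  induction k with
  | zero => decide +kernel
  | succ k ih =>
    rw [show k + 1 + 2 = (k + 2) + 1 from rfl]
    simp only [stackCount_succ_eq_sum_even 3 (k + 2), filter_parity_three]
    simp [rowCount, tileCount]
    omega

theorem knotMosaicCount_three {n : ℕ} (hn : 2 ≤ n) :
    5 * knotMosaicCount 3 n = 2 * (9 * 6 ^ (n - 2) + 1) := by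
  obtain ⟨k, rfl⟩ := Nat.exists_eq_add_of_le' hn
  rw [knotMosaicCount_comm, knotMosaicCount_eq_stackCount (by omega) (by omega)]
  rw [show (fun _ : Fin 3 => false) = ![false, false, false] by decide, Nat.add_sub_cancel]
  exact (stackCount_three k).1

theorem filter_parity_four : (Finset.univ.filter fun t => parity 4 t = false) =
    {![false, false, false, false], ![true, false, false, true],
      ![true, true, false, false], ![false, true, false, true],
      ![false, false, true, true], ![true, false, true, false],
      ![false, true, true, false], ![true, true, true, true]} := by
  decide

/-- The value of `stackCount 4 (k + 1)` at a pattern of even parity, which depends only on the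
number of `true` entries among the two middle ones. -/
def stackCountFour : ℕ → Fin 3 → ℕ
  | 0 => ![1, 1, 1]
  | k + 1 =>
      let v := stackCountFour k
      ![2 * v 0 + 4 * v 1 + 2 * v 2, 2 * v 0 + 7 * v 1 + 5 * v 2, 2 * v 0 + 10 * v 1 + 17 * v 2]

theorem stackCount_four (k : ℕ) :
    (stackCount 4 (k + 1) ![false, false, false, false] = stackCountFour k 0 ∧
      stackCount 4 (k + 1) ![true, false, false, true] = stackCountFour k 0) ∧
    (stackCount 4 (k + 1) ![true, true, false, false] = stackCountFour k 1 ∧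
      stackCount 4 (k + 1) ![false, true, false, true] = stackCountFour k 1 ∧
      stackCount 4 (k + 1) ![false, false, true, true] = stackCountFour k 1 ∧
      stackCount 4 (k + 1) ![true, false, true, false] = stackCountFour k 1) ∧
    stackCount 4 (k + 1) ![false, true, true, false] = stackCountFour k 2 ∧
      stackCount 4 (k + 1) ![true, true, true, true] = stackCountFour k 2 := by
  induction k with
  | zero => decide +kernel
  | succ k ih =>
    simp only [stackCount_succ_eq_sum_even 4 (k + 1), filter_parity_four]
    simp [rowCount, tileCount, stackCountFour, ih]
    omega

theorem knotMosaicCount_four {n : ℕ} (hn : 1 ≤ n) :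
    knotMosaicCount 4 n = stackCountFour (n - 1) 0 := by
  obtain ⟨k, rfl⟩ := Nat.exists_eq_add_of_le' hn
  rw [knotMosaicCount_comm, knotMosaicCount_eq_stackCount (by omega) (by omega)]
  rw [show (fun _ : Fin 4 => false) = ![false, false, false, false] by decide, Nat.add_sub_cancel]
  exact (stackCount_four k).1.1

theorem fullRowCount_bound {n : ℕ} (hn : 9 ≤ n) :
    11 * 5 ^ (n - 3) * fullRowCount n false ≤ 65 * 22 ^ (n - 3) := by
  have slope (n : ℕ) : 5 * fullRowCount n true ≤ 17 * fullRowCount n false := by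
    induction n with
    | zero => decide
    | succ n ih => simp only [fullRowCount]; omega
  induction n, hn using Nat.le_induction with
  | base => decide
  | succ n hn ih =>
    have h := slope n
    rw [show n + 1 - 3 = (n - 3) + 1 by omega]
    calc 11 * 5 ^ (n - 3 + 1) * fullRowCount (n + 1) false
        = 11 * 5 ^ (n - 3) * (5 * (fullRowCount n false + fullRowCount n true)) := by
          rw [fullRowCount]; ring
      _ ≤ 11 * 5 ^ (n - 3) * (22 * fullRowCount n false) :=
          Nat.mul_le_mul_left _ (by omega)
      _ = 22 * (11 * 5 ^ (n - 3) * fullRowCount n false) := by ring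
      _ ≤ 22 * (65 * 22 ^ (n - 3)) := Nat.mul_le_mul_left _ ih
      _ = 65 * 22 ^ (n - 3 + 1) := by ring

/-- The inequality of the main theorem. -/
def UpperBound (m n : ℕ) : Prop :=
  275 * 5 ^ ((m - 3) * (n - 3)) * knotMosaicCount m n ≤
    22 ^ ((m - 3) * (n - 3)) * (2 * (9 * 6 ^ (m - 2) + 1) * (9 * 6 ^ (n - 2) + 1))

theorem UpperBound.symm {m n : ℕ} (h : UpperBound m n) : UpperBound n m := by
  unfold UpperBound at *
  rw [knotMosaicCount_comm, mul_comm (n - 3)]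
  linarith

theorem upperBound_three {n : ℕ} (hn : 2 ≤ n) : UpperBound 3 n := by
  have h := knotMosaicCount_three hn
  unfold UpperBound
  norm_num
  omega

theorem upperBound_of_nine_le {m n : ℕ} (hm : 3 ≤ m) (hn : 9 ≤ n) : UpperBound m n := by
  induction m, hm using Nat.le_induction with
  | base => exact upperBound_three (by omega)
  | succ m hm ih =>
    obtain ⟨k, rfl⟩ := Nat.exists_eq_add_of_le' hm
    have hstep := knotMosaicCount_succ_le (m := k + 3) (n := n) (by omega) (by omega)
    have hrow := fullRowCount_bound hn
    unfold UpperBound at *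
    simp only [show k + 3 + 1 - 3 = k + 1 by omega, show k + 3 + 1 - 2 = k + 2 by omega,
      show k + 3 - 3 = k by omega, show k + 3 - 2 = k + 1 by omega] at *
    have hratio : 65 * (9 * 6 ^ (k + 1) + 1) ≤ 11 * (9 * 6 ^ (k + 2) + 1) := by
      have : 1 ≤ 6 ^ k := Nat.one_le_pow _ _ (by norm_num)
      rw [pow_add, pow_add]
      omega
    refine Nat.le_of_mul_le_mul_left (c := 11) ?_ (by norm_num)
    calc 11 * (275 * 5 ^ ((k + 1) * (n - 3)) * knotMosaicCount (k + 3 + 1) n)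
        ≤ 11 * (275 * 5 ^ ((k + 1) * (n - 3)) *
            (fullRowCount n false * knotMosaicCount (k + 3) n)) := by gcongr
      _ = (11 * 5 ^ (n - 3) * fullRowCount n false) *
            (275 * 5 ^ (k * (n - 3)) * knotMosaicCount (k + 3) n) := by ring
      _ ≤ (65 * 22 ^ (n - 3)) * (22 ^ (k * (n - 3)) *
            (2 * (9 * 6 ^ (k + 1) + 1) * (9 * 6 ^ (n - 2) + 1))) := Nat.mul_le_mul hrow ih
      _ = 22 ^ ((k + 1) * (n - 3)) * (2 * (65 * (9 * 6 ^ (k + 1) + 1)) *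
            (9 * 6 ^ (n - 2) + 1)) := by ring
      _ ≤ 22 ^ ((k + 1) * (n - 3)) * (2 * (11 * (9 * 6 ^ (k + 2) + 1)) *
            (9 * 6 ^ (n - 2) + 1)) := by gcongr
      _ = _ := by ring

theorem upperBound_four {n : ℕ} (hn : 4 ≤ n) (hn' : n ≤ 8) : UpperBound 4 n := by
  unfold UpperBound
  rw [knotMosaicCount_four (by omega)]
  interval_cases n <;> decide +kernel

theorem upperBound_of_le_eight {m n : ℕ} (hm : 4 ≤ m) (hm' : m ≤ 8) (hn : 5 ≤ n) (hn' : n ≤ 8) :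
    UpperBound m n := by
  have h := knotMosaicCount_add_le (m := 4) (n := n) (m - 4) (by norm_num) (by omega)
  rw [Nat.add_sub_cancel' hm, knotMosaicCount_four (by omega)] at h
  refine (Nat.mul_le_mul_left _ h).trans ?_
  clear h
  interval_cases m <;> interval_cases n <;> decide +kernel

/-- For all integers `m, n ≥ 3`,
`275 · D_{m,n} ≤ (4.4)^{(m-3)(n-3)} · 2(9·6^{m-2}+1)(9·6^{n-2}+1)`, stated in the
equivalent integer form
`275 · 5^{(m-3)(n-3)} · D_{m,n} ≤ 22^{(m-3)(n-3)} · 2(9·6^{m-2}+1)(9·6^{n-2}+1)`. -/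
theorem knotMosaicCount_upper_bound (m n : ℕ) (hm : 3 ≤ m) (hn : 3 ≤ n) :
    275 * 5 ^ ((m - 3) * (n - 3)) * knotMosaicCount m n ≤
      22 ^ ((m - 3) * (n - 3)) *
        (2 * (9 * 6 ^ (m - 2) + 1) * (9 * 6 ^ (n - 2) + 1)) := by
  change UpperBound m n
  rcases le_or_gt 9 n with hn' | hn'
  · exact upperBound_of_nine_le hm hn'
  rcases le_or_gt 9 m with hm' | hm'
  · exact (upperBound_of_nine_le hn hm').symm
  rcases hm.eq_or_lt with rfl | hm₃
  · exact upperBound_three (by omega)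
  rcases hn.eq_or_lt with rfl | hn₃
  · exact (upperBound_three (by omega)).symm
  have hm₈ : m ≤ 8 := by omega
  have hn₈ : n ≤ 8 := by omega
  rcases (show 4 ≤ n from hn₃).eq_or_lt with rfl | hn₄
  · exact (upperBound_four hm₃ hm₈).symm
  exact upperBound_of_le_eight hm₃ hm₈ hn₄ hn₈
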